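/- Let n = 1 and suppose ∫_1^∞ (f(ζ) ζ)^{−1/2} dζ < ∞. Then every global weak solution u of u_tt − Δu ≥ f(|u|) in ℝ^{n+1}_+ with u(·,0) = u_0 and u_t(·,0) = u_1 is trivial, i.e. u = 0 almost everywhere in ℝ^{n+1}_+. -/

import Mathlib

open MeasureTheory Real Set Filter

noncomputable section

/-- The spatial domain `ℝⁿ`. -/
abbrev Spc (n : ℕ) := EuclideanSpace ℝ (Fin n)

/-- The open ball `B_r` in `ℝⁿ` of radius `r` centered at `0`. -/
def ball0 (n : ℕ) (r : ℝ) : Set (Spc n) := Metric.ball 0 r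

/-- The cylinder `Q_r^κ = B_r × (0, r^κ)`. -/
def cyl (n : ℕ) (r κ : ℝ) : Set (Spc n × ℝ) := ball0 n r ×ˢ Ioo 0 (r ^ κ)

/-- The half-space `ℝ^{n+1}_+ = ℝⁿ × (0, ∞)`. -/
def halfSp (n : ℕ) : Set (Spc n × ℝ) := {z | 0 < z.2}

/-- The (finite) set of multi-indices `α` with `|α| = m`. -/
def mIdx (n m : ℕ) : Finset (Fin n → ℕ) :=
  (Fintype.piFinset fun _ : Fin n => Finset.range (m + 1)).filter fun α => ∑ i, α i = m

/-- Spatial partial derivative `∂/∂x_i`. -/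
def spDeriv (n : ℕ) (i : Fin n) (φ : Spc n × ℝ → ℝ) : Spc n × ℝ → ℝ :=
  fun z => deriv (fun s : ℝ => φ (z.1 + s • EuclideanSpace.single i (1 : ℝ), z.2)) 0

/-- Time derivative `∂/∂t`. -/
def tDeriv (n : ℕ) (φ : Spc n × ℝ → ℝ) : Spc n × ℝ → ℝ :=
  fun z => deriv (fun s : ℝ => φ (z.1, s)) z.2

/-- Multi-index spatial derivative `∂^α`. -/
def mDeriv (n : ℕ) (α : Fin n → ℕ) (φ : Spc n × ℝ → ℝ) : Spc n × ℝ → ℝ :=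
  (List.finRange n).foldr (fun i ψ => (spDeriv n i)^[α i] ψ) φ

/-- Caratheodory conditions and the growth bound `|a_α(x,t,ζ)| ≤ A |ζ|^p` for the
coefficients of the operator `L`. -/
def GoodCoeffs (n m : ℕ) (A p : ℝ) (a : (Fin n → ℕ) → Spc n × ℝ → ℝ → ℝ) : Prop :=
  ∀ α ∈ mIdx n m,
    (∀ ζ : ℝ, Measurable fun z => a α z ζ) ∧
    (∀ᵐ z ∂(volume.restrict (halfSp n)), Continuous fun ζ => a α z ζ) ∧
    (∀ᵐ z ∂(volume.restrict (halfSp n)), ∀ ζ : ℝ, |a α z ζ| ≤ A * |ζ| ^ p)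

/-- The standing conditions on `f`: `ζ ↦ f ζ` and `ζ ↦ f (ζ^{1/p})` are nondecreasing
and convex on `[0,∞)`, and `f` is positive on `(0,∞)`. -/
def GoodF (p : ℝ) (f : ℝ → ℝ) : Prop :=
  MonotoneOn f (Ici 0) ∧ ConvexOn ℝ (Ici 0) f ∧
  MonotoneOn (fun ζ => f (ζ ^ (1 / p))) (Ici 0) ∧
  ConvexOn ℝ (Ici 0) (fun ζ => f (ζ ^ (1 / p))) ∧
  ∀ ζ : ℝ, 0 < ζ → 0 < f ζ

/-- Condition (1.4): `∫_1^∞ ζ^{1/k - 1} f(ζ)^{-1/k} dζ < ∞`. -/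
def Cond14 (k : ℕ) (f : ℝ → ℝ) : Prop :=
  IntegrableOn (fun ζ : ℝ => ζ ^ ((k : ℝ)⁻¹ - 1) / f ζ ^ ((k : ℝ)⁻¹)) (Ioi 1)

/-- Condition (1.5): `∫_1^∞ ζ^{p/m - 1} f(ζ)^{-1/m} dζ < ∞`. -/
def Cond15 (m : ℕ) (p : ℝ) (f : ℝ → ℝ) : Prop :=
  IntegrableOn (fun ζ : ℝ => ζ ^ (p / (m : ℝ) - 1) / f ζ ^ ((m : ℝ)⁻¹)) (Ioi 1)

/-- `v ∈ L^1_loc(ℝⁿ)`. -/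
def L1locInit (n : ℕ) (v : Spc n → ℝ) : Prop :=
  ∀ r : ℝ, 0 < r → IntegrableOn v (ball0 n r)

/-- `u` is a global weak solution of
`∂_t^k u - Σ_{|α| = m} ∂^α a_α(x,t,u) ≥ f(|u|)` in `ℝ^{n+1}_+`, with initial data
`∂_t^i u(·,0) = u0 i` for `0 ≤ i ≤ k-1`. -/
def IsGlobalWeakSol (n k m : ℕ) (p : ℝ) (a : (Fin n → ℕ) → Spc n × ℝ → ℝ → ℝ)
    (f : ℝ → ℝ) (u0 : ℕ → Spc n → ℝ) (u : Spc n × ℝ → ℝ) : Prop :=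
  (∀ r : ℝ, 0 < r → IntegrableOn u (cyl n r 1)) ∧
  (∀ r : ℝ, 0 < r → IntegrableOn (fun z => |u z| ^ p) (cyl n r 1)) ∧
  (∀ r : ℝ, 0 < r → IntegrableOn (fun z => f |u z|) (cyl n r 1)) ∧
  ∀ φ : Spc n × ℝ → ℝ, ContDiff ℝ (⊤ : ℕ∞) φ → HasCompactSupport φ →
    (∀ z, 0 ≤ φ z) →
    (∫ z in halfSp n, (-1 : ℝ) ^ k * u z * (tDeriv n)^[k] φ z)
      - (∫ z in halfSp n, ∑ α ∈ mIdx n m, (-1 : ℝ) ^ m * a α z (u z) * mDeriv n α φ z)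
    ≥ (∫ x : Spc n, ∑ i ∈ Finset.range k,
          (-1 : ℝ) ^ i * u0 (k - 1 - i) x * (tDeriv n)^[i] φ (x, 0))
      + ∫ z in halfSp n, f |u z| * φ z

/-- `u = 0` almost everywhere in `ℝ^{n+1}_+`. -/
def TrivialSol (n : ℕ) (u : Spc n × ℝ → ℝ) : Prop :=
  ∀ᵐ z ∂(volume.restrict (halfSp n)), u z = 0

/-- `u` is a global weak solution of the wave inequality
`u_tt - Δu ≥ f(|u|)` in `ℝ^{n+1}_+` with `u(·,0) = u0`, `u_t(·,0) = u1`. -/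
def IsGlobalWeakSolWave (n : ℕ) (f : ℝ → ℝ) (u0 u1 : Spc n → ℝ)
    (u : Spc n × ℝ → ℝ) : Prop :=
  (∀ r : ℝ, 0 < r → IntegrableOn u (cyl n r 1)) ∧
  (∀ r : ℝ, 0 < r → IntegrableOn (fun z => f |u z|) (cyl n r 1)) ∧
  ∀ φ : Spc n × ℝ → ℝ, ContDiff ℝ (⊤ : ℕ∞) φ → HasCompactSupport φ →
    (∀ z, 0 ≤ φ z) →
    (∫ z in halfSp n, u z * ((tDeriv n)^[2] φ z - ∑ i : Fin n, (spDeriv n i)^[2] φ z))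
    ≥ (∫ x : Spc n, (u1 x * φ (x, 0) - u0 x * tDeriv n φ (x, 0)))
      + ∫ z in halfSp n, f |u z| * φ z

lemma exists_bound_deriv_smoothTransition :
    ∃ M : ℝ, 0 < M ∧ (∀ x, |deriv smoothTransition x| ≤ M) ∧
      ∀ x, |deriv (deriv smoothTransition) x| ≤ M := by
  have h1 : ContDiff ℝ 1 (deriv smoothTransition) :=
    ContDiff.deriv' (n := 1) smoothTransition.contDiff
  have h2 : Continuous (deriv (deriv smoothTransition)) := h1.continuous_deriv le_rfl
  have hz : ∀ x, x ∉ Icc (0 : ℝ) 1 →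
      ∃ c : ℝ, smoothTransition =ᶠ[nhds x] fun _ => c := by
    intro x hx
    rcases lt_or_ge x 0 with h | h
    · refine ⟨0, ?_⟩
      filter_upwards [eventually_lt_nhds h] with y hy
      exact smoothTransition.zero_of_nonpos hy.le
    · have h' : 1 < x := by
        by_contra hc
        exact hx ⟨h, not_lt.1 hc⟩
      refine ⟨1, ?_⟩
      filter_upwards [eventually_gt_nhds h'] with y hy
      exact smoothTransition.one_of_one_le hy.le
  have hc1 : HasCompactSupport (deriv smoothTransition) :=
    HasCompactSupport.intro isCompact_Icc fun x hx => by
      obtain ⟨c, hc⟩ := hz x hx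
      rw [hc.deriv_eq]; simp
  have hc2 : HasCompactSupport (deriv (deriv smoothTransition)) :=
    HasCompactSupport.intro isCompact_Icc fun x hx => by
      obtain ⟨c, hc⟩ := hz x hx
      rw [hc.deriv.deriv_eq]; simp
  obtain ⟨M1, hM1⟩ := hc1.exists_bound_of_continuous h1.continuous
  obtain ⟨M2, hM2⟩ := hc2.exists_bound_of_continuous h2
  refine ⟨max 1 (max M1 M2), by positivity, fun x => ?_, fun x => ?_⟩
  · exact (hM1 x).trans (by simp)
  · exact (hM2 x).trans (by simp)

/-- Smooth cutoffs between radii `R < r`, with second derivative of order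
`(r - R)⁻²`. -/
lemma exists_cutoff :
    ∃ C : ℝ, 0 < C ∧ ∀ R r : ℝ, 0 < R → R < r → ∃ G : ℝ → ℝ,
      ContDiff ℝ (⊤ : ℕ∞) G ∧ (∀ y, 0 ≤ G y) ∧ (∀ y, G y ≤ 1) ∧
      (∀ y, |y| < R → G y = 1) ∧ (∀ y, r ≤ |y| → G y = 0) ∧
      (∀ y, |y| < R → deriv G y = 0) ∧
      (∀ y, |y| < R → deriv (deriv G) y = 0) ∧
      (∀ y, r ≤ |y| → deriv (deriv G) y = 0) ∧
      ∀ y, |deriv (deriv G) y| ≤ C / (r - R) ^ 2 := by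
  obtain ⟨M, hM, hM1, hM2⟩ := exists_bound_deriv_smoothTransition
  refine ⟨4 * (2 * M + 2 * M ^ 2), by positivity, fun R r hR hr => ?_⟩
  set δ : ℝ := (r - R) / 2 with hδ
  have hδ0 : 0 < δ := by rw [hδ]; linarith
  set ρ : ℝ := (r + R) / 2 with hρ
  set S := smoothTransition with hSdef
  have hS : ContDiff ℝ (⊤ : ℕ∞) S := smoothTransition.contDiff
  have hS2 : ContDiff ℝ 2 S := smoothTransition.contDiff
  have hS' : ContDiff ℝ 1 (deriv S) := ContDiff.deriv' (n := 1) smoothTransition.contDiff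
  have hdS : ∀ x, HasDerivAt S (deriv S x) x := fun x =>
    (hS2.differentiable (by norm_num) x).hasDerivAt
  have hdS' : ∀ x, HasDerivAt (deriv S) (deriv (deriv S) x) x := fun x =>
    (hS'.differentiable (by norm_num) x).hasDerivAt
  have hl : ∀ y, HasDerivAt (fun y : ℝ => (ρ - y) / δ) (-1 / δ) y := fun y =>
    ((hasDerivAt_id y).const_sub ρ).div_const δ
  have hp : ∀ y, HasDerivAt (fun y : ℝ => (ρ + y) / δ) (1 / δ) y := fun y =>
    ((hasDerivAt_id y).const_add ρ).div_const δ
  set G : ℝ → ℝ := fun y => S ((ρ - y) / δ) * S ((ρ + y) / δ) with hG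
  have hone : ∀ y, |y| < R → G y = 1 := by
    intro y hy
    obtain ⟨h1, h2⟩ := abs_lt.1 hy
    have e1 : 1 ≤ (ρ - y) / δ := by rw [le_div_iff₀ hδ0]; linarith
    have e2 : 1 ≤ (ρ + y) / δ := by rw [le_div_iff₀ hδ0]; linarith
    simp only [hG, hSdef]
    rw [smoothTransition.one_of_one_le e1, smoothTransition.one_of_one_le e2, one_mul]
  have hzero : ∀ y, ρ < |y| → G y = 0 := by
    intro y hy
    simp only [hG, hSdef]
    rcases lt_abs.1 hy with h | h
    · rw [smoothTransition.zero_of_nonpos (x := (ρ - y) / δ)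
        (div_nonpos_of_nonpos_of_nonneg (by linarith) hδ0.le), zero_mul]
    · rw [smoothTransition.zero_of_nonpos (x := (ρ + y) / δ)
        (div_nonpos_of_nonpos_of_nonneg (by linarith) hδ0.le), mul_zero]
  have hone' : ∀ y, |y| < R → G =ᶠ[nhds y] fun _ => 1 := fun y hy => by
    filter_upwards [continuous_abs.continuousAt.eventually_lt_const hy] with w hw
    exact hone w hw
  have hzero' : ∀ y, r ≤ |y| → G =ᶠ[nhds y] fun _ => 0 := fun y hy => by
    have : ρ < |y| := by linarith
    filter_upwards [continuous_abs.continuousAt.eventually_const_lt this] with w hw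
    exact hzero w hw
  have hG1 : deriv G = fun y => (-1 / δ) * (deriv S ((ρ - y) / δ) * S ((ρ + y) / δ)) +
      (1 / δ) * (S ((ρ - y) / δ) * deriv S ((ρ + y) / δ)) := by
    funext y
    have := (((hdS _).comp y (hl y)).mul ((hdS _).comp y (hp y))).deriv
    refine Eq.trans this ?_
    simp only [Function.comp]; ring
  have hG2 : ∀ y, deriv (deriv G) y = (deriv (deriv S) ((ρ - y) / δ) * S ((ρ + y) / δ)
      - 2 * (deriv S ((ρ - y) / δ) * deriv S ((ρ + y) / δ))
      + S ((ρ - y) / δ) * deriv (deriv S) ((ρ + y) / δ)) / δ ^ 2 := by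
    intro y
    rw [hG1]
    have := (((((hdS' _).comp y (hl y)).mul ((hdS _).comp y (hp y))).const_mul (-1 / δ)).add
      ((((hdS _).comp y (hl y)).mul ((hdS' _).comp y (hp y))).const_mul (1 / δ))).deriv
    refine Eq.trans this ?_
    simp only [Function.comp]; field_simp; ring
  have hSa : ∀ x, |S x| ≤ 1 := fun x => by
    rw [abs_of_nonneg (smoothTransition.nonneg x)]
    exact smoothTransition.le_one x
  refine ⟨G, ?_, ?_, ?_, hone, fun y hy => hzero y (by linarith), ?_, ?_, ?_, ?_⟩
  · exact (hS.comp (by fun_prop)).mul (hS.comp (by fun_prop))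
  · exact fun y => mul_nonneg (smoothTransition.nonneg _) (smoothTransition.nonneg _)
  · exact fun y => mul_le_one₀ (smoothTransition.le_one _) (smoothTransition.nonneg _)
      (smoothTransition.le_one _)
  · exact fun y hy => by rw [(hone' y hy).deriv_eq]; simp
  · exact fun y hy => by rw [(hone' y hy).deriv.deriv_eq]; simp
  · exact fun y hy => by rw [(hzero' y hy).deriv.deriv_eq]; simp
  · intro y
    have hrR : (r - R) = 2 * δ := by rw [hδ]; ring
    rw [hG2, hrR, abs_div, abs_of_pos (by positivity : 0 < δ ^ 2), mul_pow,
      div_le_div_iff₀ (by positivity) (by positivity)]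
    set a := deriv (deriv S) ((ρ - y) / δ) * S ((ρ + y) / δ)
    set b := deriv S ((ρ - y) / δ) * deriv S ((ρ + y) / δ)
    set c := S ((ρ - y) / δ) * deriv (deriv S) ((ρ + y) / δ)
    have ha : |a| ≤ M := by
      rw [abs_mul]
      simpa using mul_le_mul (hM2 _) (hSa _) (abs_nonneg _) hM.le
    have hb : |b| ≤ M ^ 2 := by
      rw [abs_mul, pow_two]
      exact mul_le_mul (hM1 _) (hM1 _) (abs_nonneg _) hM.le
    have hc : |c| ≤ M := by
      rw [abs_mul]
      simpa using mul_le_mul (hSa _) (hM2 _) (abs_nonneg _) zero_le_one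
    have habc : |a - 2 * b + c| ≤ 2 * M + 2 * M ^ 2 := by
      rw [abs_le] at *
      constructor <;> linarith [ha.1, hb.1, hc.1, ha.2, hb.2, hc.2]
    nlinarith [mul_le_mul_of_nonneg_right habc (by positivity : 0 ≤ 4 * δ ^ 2)]

/-- An integral form of the Osgood-type blow-up: the growth inequality cannot hold on a long
interval. -/
lemma not_growth_of_integrable {f h : ℝ → ℝ} (hf_mono : MonotoneOn f (Ici 0))
    (hf_pos : ∀ ζ : ℝ, 0 < ζ → 0 < f ζ)
    (hint : IntegrableOn (fun ζ : ℝ => (f ζ * ζ) ^ (-(1 : ℝ) / 2)) (Ioi 1))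
    {κ a L B : ℝ} (hκ : 0 < κ) (ha : 2 ≤ h a)
    (hB : ∀ r, a ≤ r → r ≤ a + L → h r ≤ B)
    (hgrow : ∀ r s, a ≤ r → r < s → s ≤ a + L →
      h r + κ * (s - r) ^ 2 * f (h r) ≤ h s)
    (hL : 2 / √κ * (∫ ζ in Ioi (1 : ℝ), (f ζ * ζ) ^ (-(1 : ℝ) / 2)) ≤ L) : False := by
  set g : ℝ → ℝ := fun ζ => (f ζ * ζ) ^ (-(1 : ℝ) / 2) with hg
  set d : ℕ → ℝ := fun i => √(2 ^ (i + 1) / (κ * f (2 ^ (i + 1)))) with hd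
  have hfp : ∀ i : ℕ, 0 < f (2 ^ i) := fun i => hf_pos _ (by positivity)
  have hd0 : ∀ i, 0 < d i := fun i => by
    have := hfp (i + 1)
    exact Real.sqrt_pos.2 (by positivity)
  have hone : ∀ i : ℕ, (1 : ℝ) ≤ 2 ^ i := fun i => one_le_pow₀ (by norm_num)
  have hstep : ∀ i : ℕ, d i ≤ 2 / √κ * ∫ ζ in Ioc ((2 : ℝ) ^ i) (2 ^ (i + 1)), g ζ := by
    intro i
    set Z : ℝ := 2 ^ (i + 1) with hZ
    have hZ0 : 0 < Z := by positivity
    have hfZ : 0 < f Z := hf_pos _ hZ0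
    have hle : ∀ ζ ∈ Ioc ((2 : ℝ) ^ i) Z, g Z ≤ g ζ := by
      intro ζ hζ
      have h0 : 0 < ζ := lt_of_lt_of_le (by positivity) hζ.1.le
      have h1 := hf_pos ζ h0
      refine Real.rpow_le_rpow_of_nonpos (by positivity) ?_ (by norm_num)
      exact mul_le_mul (hf_mono h0.le hZ0.le hζ.2) hζ.2 h0.le hfZ.le
    have hi : IntegrableOn g (Ioc ((2 : ℝ) ^ i) Z) :=
      hint.mono_set fun ζ hζ => lt_of_le_of_lt (hone i) hζ.1
    have h1 := setIntegral_mono_on (integrableOn_const (by simp)) hi measurableSet_Ioc hle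
    have hZi : Z - 2 ^ i = Z / 2 := by rw [hZ, pow_succ]; ring
    have h2i : (2 : ℝ) ^ i ≤ Z := by
      have : 0 < Z / 2 := by positivity
      linarith
    rw [setIntegral_const, measureReal_def, Real.volume_Ioc,
      ENNReal.toReal_ofReal (by linarith), hZi, smul_eq_mul] at h1
    have h3 : d i = 2 / √κ * (Z / 2 * g Z) := by
      simp only [hd, hg]
      rw [show (-(1 : ℝ) / 2) = -(1 / 2) by norm_num, Real.rpow_neg (by positivity),
        ← Real.sqrt_eq_rpow, Real.sqrt_div hZ0.le, Real.sqrt_mul hκ.le, Real.sqrt_mul hfZ.le]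
      have a1 := Real.sqrt_pos.2 hκ
      have a2 := Real.sqrt_pos.2 hfZ
      have a3 := Real.sqrt_pos.2 hZ0
      rw [← hZ]
      field_simp
      rw [Real.sq_sqrt hZ0.le]
    rw [h3]
    exact mul_le_mul_of_nonneg_left h1 (by positivity)
  have hsum : ∀ N : ℕ, ∑ i ∈ Finset.range N, d i
      ≤ 2 / √κ * ∫ ζ in Ioc (1 : ℝ) (2 ^ N), g ζ := by
    intro N
    induction N with
    | zero => simp
    | succ N ih =>
      have hu : Ioc (1 : ℝ) (2 ^ (N + 1)) = Ioc 1 (2 ^ N) ∪ Ioc (2 ^ N) (2 ^ (N + 1)) :=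
        (Ioc_union_Ioc_eq_Ioc (hone N) (pow_le_pow_right₀ (by norm_num) (by omega))).symm
      rw [Finset.sum_range_succ, hu, setIntegral_union (Ioc_disjoint_Ioc_of_le le_rfl)
        measurableSet_Ioc (hint.mono_set fun ζ hζ => hζ.1)
        (hint.mono_set fun ζ hζ => lt_of_le_of_lt (hone N) hζ.1), mul_add]
      exact add_le_add ih (hstep N)
  have htot : ∀ N : ℕ, ∑ i ∈ Finset.range N, d i ≤ L := by
    intro N
    refine (hsum N).trans (le_trans ?_ hL)
    refine mul_le_mul_of_nonneg_left ?_ (by positivity)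
    refine setIntegral_mono_set hint ?_ (Eventually.of_forall fun ζ hζ => hζ.1)
    filter_upwards [ae_restrict_mem measurableSet_Ioi] with ζ hζ
    have h0 : (0 : ℝ) < ζ := lt_trans one_pos hζ
    have := hf_pos ζ h0
    simp only [Pi.zero_apply]
    positivity
  have hind : ∀ N : ℕ, (2 : ℝ) ^ (N + 1) ≤ h (a + ∑ i ∈ Finset.range N, d i) := by
    intro N
    induction N with
    | zero => simpa using ha
    | succ N ih =>
      set r := a + ∑ i ∈ Finset.range N, d i with hr
      have hs : a + ∑ i ∈ Finset.range (N + 1), d i = r + d N := by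
        rw [Finset.sum_range_succ, hr]; ring
      have h1 := hgrow r (r + d N)
        (by rw [hr]; linarith [Finset.sum_nonneg fun i (_ : i ∈ Finset.range N) => (hd0 i).le])
        (by linarith [hd0 N]) (by rw [← hs]; linarith [htot (N + 1)])
      rw [hs]
      refine le_trans ?_ h1
      have hf1 : f (2 ^ (N + 1)) ≤ f (h r) :=
        hf_mono (mem_Ici.2 (by positivity)) (mem_Ici.2 (le_trans (by positivity) ih)) ih
      have hfN := hfp (N + 1)
      have h2 : κ * (r + d N - r) ^ 2 * f (2 ^ (N + 1)) = 2 ^ (N + 1) := by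
        rw [add_sub_cancel_left, Real.sq_sqrt (by positivity)]
        field_simp
      have h3 : κ * (r + d N - r) ^ 2 * f (2 ^ (N + 1)) ≤
          κ * (r + d N - r) ^ 2 * f (h r) := mul_le_mul_of_nonneg_left hf1 (by positivity)
      rw [pow_succ (2 : ℝ) (N + 1)]
      linarith
  obtain ⟨N, hN⟩ := pow_unbounded_of_one_lt B (by norm_num : (1 : ℝ) < 2)
  have h1 := hind N
  have h2 := hB _ (by linarith [Finset.sum_nonneg fun i (_ : i ∈ Finset.range N) => (hd0 i).le])
    (by linarith [htot N] : a + ∑ i ∈ Finset.range N, d i ≤ a + L)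
  rw [pow_succ] at h1
  linarith [hone N]

lemma ConvexOn.continuousOn_Ici_of_monotoneOn {f : ℝ → ℝ} (hf_mono : MonotoneOn f (Ici 0))
    (hf_conv : ConvexOn ℝ (Ici 0) f) : ContinuousOn f (Ici 0) := by
  intro x hx
  rcases eq_or_lt_of_le (mem_Ici.1 hx) with h | h
  · subst h
    have hup : Tendsto (fun y : ℝ => (1 - y) * f 0 + y * f 1) (nhdsWithin 0 (Ici 0))
        (nhds (f 0)) := by
      have : Continuous fun y : ℝ => (1 - y) * f 0 + y * f 1 := by fun_prop
      simpa using (this.tendsto 0).mono_left nhdsWithin_le_nhds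
    refine tendsto_of_tendsto_of_tendsto_of_le_of_le' tendsto_const_nhds hup ?_ ?_
    · filter_upwards [self_mem_nhdsWithin] with y hy
      exact hf_mono hx hy hy
    · filter_upwards [self_mem_nhdsWithin,
        mem_nhdsWithin_of_mem_nhds (eventually_lt_nhds (zero_lt_one' ℝ))] with y hy hy1
      have := hf_conv.2 (mem_Ici.2 le_rfl) (mem_Ici.2 zero_le_one)
        (sub_nonneg.2 (le_of_lt hy1)) hy (by ring)
      simpa using this
  · have := hf_conv.continuousOn_interior
    rw [interior_Ici] at this
    exact (this.continuousAt (Ioi_mem_nhds h)).continuousWithinAt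

lemma ConvexOn.nonneg_of_pos {f : ℝ → ℝ} (hf_mono : MonotoneOn f (Ici 0))
    (hf_conv : ConvexOn ℝ (Ici 0) f) (hf_pos : ∀ ζ : ℝ, 0 < ζ → 0 < f ζ) {ζ : ℝ}
    (hζ : 0 ≤ ζ) : 0 ≤ f ζ := by
  rcases hζ.eq_or_lt with h | h
  · subst h
    have hc : Tendsto f (nhdsWithin 0 (Ioi 0)) (nhds (f 0)) :=
      ((hf_conv.continuousOn_Ici_of_monotoneOn hf_mono) 0 (mem_Ici.2 le_rfl)).mono
        Ioi_subset_Ici_self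
    refine ge_of_tendsto hc ?_
    filter_upwards [self_mem_nhdsWithin] with y hy
    exact (hf_pos y hy).le
  · exact (hf_pos ζ h).le

lemma mem_cyl_one {R : ℝ} {z : Spc 1 × ℝ} : z ∈ cyl 1 R 1 ↔ |z.1 0| < R ∧ 0 < z.2 ∧ z.2 < R := by
  simp [cyl, ball0, EuclideanSpace.norm_eq, Real.sqrt_sq_eq_abs]

lemma measurableSet_cyl (n : ℕ) (R κ : ℝ) : MeasurableSet (cyl n R κ) :=
  measurableSet_ball.prod measurableSet_Ioo

lemma measurableSet_halfSp (n : ℕ) : MeasurableSet (halfSp n) :=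
  measurableSet_lt measurable_const measurable_snd

lemma cyl_one_mono {R r : ℝ} (h : R ≤ r) : cyl 1 R 1 ⊆ cyl 1 r 1 := fun z hz => by
  rw [mem_cyl_one] at *
  exact ⟨hz.1.trans_le h, hz.2.1, hz.2.2.trans_le h⟩

lemma cyl_one_subset_halfSp (R : ℝ) : cyl 1 R 1 ⊆ halfSp 1 := fun _ hz => (mem_cyl_one.1 hz).2.1

lemma volume_cyl_one : ∃ ω : ℝ, 0 < ω ∧ ∀ R : ℝ, 0 < R →
    volume (cyl 1 R 1) = ENNReal.ofReal (ω * R ^ 2) := by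
  refine ⟨(volume (Metric.ball (0 : Spc 1) 1)).toReal,
    ENNReal.toReal_pos (Metric.measure_ball_pos _ _ one_pos).ne' measure_ball_lt_top.ne, ?_⟩
  intro R hR
  rw [cyl, ball0, Measure.volume_eq_prod, Measure.prod_prod, Measure.addHaar_ball _ _ hR.le,
    Real.volume_Ioo, rpow_one, sub_zero]
  nth_rewrite 1 [← ENNReal.ofReal_toReal
    (measure_ball_lt_top (μ := (volume : Measure (Spc 1))) (x := 0) (r := 1)).ne]
  rw [← ENNReal.ofReal_mul (by positivity), ← ENNReal.ofReal_mul (by positivity)]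
  congr 1
  simp
  ring

lemma tDeriv_mul (A B : ℝ → ℝ) : tDeriv 1 (fun z : Spc 1 × ℝ => A (z.1 0) * B z.2) =
    fun z => A (z.1 0) * deriv B z.2 := by
  funext z
  simp only [tDeriv]
  rw [deriv_const_mul_field]

lemma spDeriv_mul (A B : ℝ → ℝ) : spDeriv 1 0 (fun z : Spc 1 × ℝ => A (z.1 0) * B z.2) =
    fun z => deriv A (z.1 0) * B z.2 := by
  funext z
  simp only [spDeriv]
  rw [deriv_mul_const_field]
  simp [deriv_comp_const_add]

/-- The a priori estimate obtained by testing the inequality with a cutoff. -/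
lemma exists_test_estimate : ∃ K : ℝ, 0 < K ∧ ∀ (f : ℝ → ℝ) (u0 u1 : Spc 1 → ℝ)
    (u : Spc 1 × ℝ → ℝ), (∀ ζ, 0 ≤ ζ → 0 ≤ f ζ) →
    (∀ᵐ x ∂(volume : Measure (Spc 1)), 0 ≤ u1 x) → IsGlobalWeakSolWave 1 f u0 u1 u →
    ∀ R r : ℝ, 0 < R → R < r →
      ∫ z in cyl 1 R 1, f |u z| ≤
        K / (r - R) ^ 2 * ((∫ z in cyl 1 r 1, |u z|) - ∫ z in cyl 1 R 1, |u z|) := by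
  obtain ⟨C, hC, hcut⟩ := exists_cutoff
  refine ⟨2 * C, by positivity, fun f u0 u1 u hf hu1 hu R r hR hr => ?_⟩
  obtain ⟨G, hGs, hG0, hG1, hGone, hGzero, hGd, hG2in, hG2out, hGb⟩ := hcut R r hR hr
  obtain ⟨hui, hfi, hw⟩ := hu
  have hr0 : 0 < r := hR.trans hr
  set φ : Spc 1 × ℝ → ℝ := fun z => G (z.1 0) * G z.2 with hφ
  have hφs : ContDiff ℝ (⊤ : ℕ∞) φ := by
    have e1 : ContDiff ℝ (⊤ : ℕ∞) fun z : Spc 1 × ℝ => z.1 0 := by fun_prop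
    exact (hGs.comp e1).mul (hGs.comp contDiff_snd)
  have hφc : HasCompactSupport φ := by
    refine HasCompactSupport.intro
      ((isCompact_closedBall (0 : Spc 1) r).prod (isCompact_Icc (a := -r) (b := r))) ?_
    intro z hz
    by_contra hne
    apply hz
    have h1 : |z.1 0| < r := by
      by_contra h
      exact hne (by simp [hφ, hGzero _ (not_lt.1 h)])
    have h2 : |z.2| < r := by
      by_contra h
      exact hne (by simp [hφ, hGzero _ (not_lt.1 h)])
    refine ⟨?_, (abs_lt.1 h2).1.le, (abs_lt.1 h2).2.le⟩
    simp only [Metric.mem_closedBall, dist_zero_right, EuclideanSpace.norm_eq, Fin.sum_univ_one,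
      Real.norm_eq_abs, sq_abs, Real.sqrt_sq_eq_abs]
    exact h1.le
  have hφ0 : ∀ z, 0 ≤ φ z := fun z => mul_nonneg (hG0 _) (hG0 _)
  have key := hw φ hφs hφc hφ0
  have hdata : 0 ≤ ∫ x : Spc 1, (u1 x * φ (x, 0) - u0 x * tDeriv 1 φ (x, 0)) := by
    refine integral_nonneg_of_ae ?_
    filter_upwards [hu1] with x hx
    have : tDeriv 1 φ (x, 0) = 0 := by
      rw [hφ, tDeriv_mul]
      simp [hGd 0 (by simpa using hR)]
    simp only [this, mul_zero, sub_zero, Pi.zero_apply]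
    exact mul_nonneg hx (hφ0 _)
  have hop : ∀ z, (tDeriv 1)^[2] φ z - ∑ i : Fin 1, (spDeriv 1 i)^[2] φ z =
      G (z.1 0) * deriv (deriv G) z.2 - deriv (deriv G) (z.1 0) * G z.2 := by
    intro z
    simp only [Function.iterate_succ, Function.iterate_zero, Function.comp, id, Fin.sum_univ_one,
      Fin.isValue, hφ, tDeriv_mul, spDeriv_mul]
  have hopin : ∀ z ∈ halfSp 1, z ∉ cyl 1 r 1 \ cyl 1 R 1 →
      G (z.1 0) * deriv (deriv G) z.2 - deriv (deriv G) (z.1 0) * G z.2 = 0 := by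
    intro z hz hn
    have hz' : 0 < z.2 := hz
    by_cases h : z ∈ cyl 1 r 1
    · have h' : z ∈ cyl 1 R 1 := by
        by_contra hc
        exact hn ⟨h, hc⟩
      obtain ⟨a, b, c⟩ := mem_cyl_one.1 h'
      rw [hG2in _ a, hG2in z.2 (by rwa [abs_of_pos b])]
      simp
    · rw [mem_cyl_one] at h
      by_cases h1 : |z.1 0| < r
      · have h2 : r ≤ |z.2| := by
          rw [abs_of_pos hz']
          by_contra hc
          exact h ⟨h1, hz', not_le.1 hc⟩
        rw [hG2out _ h2, hGzero _ h2]
        simp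
      · rw [hG2out _ (not_lt.1 h1), hGzero _ (not_lt.1 h1)]
        simp
  have hD : MeasurableSet (cyl 1 r 1 \ cyl 1 R 1) :=
    (measurableSet_cyl _ _ _).diff (measurableSet_cyl _ _ _)
  have hDs : cyl 1 r 1 \ cyl 1 R 1 ⊆ halfSp 1 := sdiff_subset.trans (cyl_one_subset_halfSp r)
  have hua : IntegrableOn (fun z => |u z|) (cyl 1 r 1) := (hui r hr0).abs
  have hlhs : ∫ z in halfSp 1, u z * ((tDeriv 1)^[2] φ z - ∑ i : Fin 1, (spDeriv 1 i)^[2] φ z) ≤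
      ∫ z in halfSp 1, (cyl 1 r 1 \ cyl 1 R 1).indicator
        (fun z => 2 * C / (r - R) ^ 2 * |u z|) z := by
    refine (le_abs_self _).trans ?_
    rw [← Real.norm_eq_abs]
    refine norm_integral_le_of_norm_le ?_ ?_
    · refine IntegrableOn.integrable ?_
      refine IntegrableOn.mono_set ?_ (subset_univ _)
      rw [integrableOn_univ, integrable_indicator_iff hD]
      exact (hua.mono_set sdiff_subset).const_mul _
    · filter_upwards [ae_restrict_mem (measurableSet_halfSp 1)] with z hz
      rw [hop]
      by_cases h : z ∈ cyl 1 r 1 \ cyl 1 R 1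
      · rw [indicator_of_mem h, Real.norm_eq_abs, abs_mul, mul_comm]
        refine mul_le_mul_of_nonneg_right ?_ (abs_nonneg _)
        refine (abs_sub _ _).trans ?_
        have hGa : ∀ y, |G y| ≤ 1 := fun y => by rw [abs_of_nonneg (hG0 y)]; exact hG1 y
        rw [abs_mul, abs_mul]
        have e1 := mul_le_mul (hGa (z.1 0)) (hGb z.2) (abs_nonneg _) zero_le_one
        have e2 := mul_le_mul (hGb (z.1 0)) (hGa z.2) (abs_nonneg _)
          ((abs_nonneg _).trans (hGb 0))
        have e3 : 2 * C / (r - R) ^ 2 = 1 * (C / (r - R) ^ 2) + C / (r - R) ^ 2 * 1 := by ring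
        rw [e3]
        exact add_le_add e1 e2
      · rw [hopin z hz h, indicator_of_notMem h]
        simp
  have hrhs : ∫ z in cyl 1 R 1, f |u z| ≤ ∫ z in halfSp 1, f |u z| * φ z := by
    have hfr : IntegrableOn (fun z => f |u z| * φ z) (halfSp 1) := by
      have h1 : IntegrableOn (fun z => f |u z| * φ z) (cyl 1 r 1) := by
        refine (hfi r hr0).mul_bdd (c := 1) hφs.continuous.aestronglyMeasurable ?_
        refine Eventually.of_forall fun z => ?_
        rw [Real.norm_eq_abs, abs_of_nonneg (hφ0 z)]
        exact mul_le_one₀ (hG1 _) (hG0 _) (hG1 _)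
      refine h1.of_forall_sdiff_eq_zero (measurableSet_halfSp 1) ?_
      intro z hz
      have hz' : 0 < z.2 := hz.1
      have h := hz.2
      rw [mem_cyl_one] at h
      by_cases h1 : |z.1 0| < r
      · have h2 : r ≤ |z.2| := by
          rw [abs_of_pos hz']
          by_contra hc
          exact h ⟨h1, hz', not_le.1 hc⟩
        simp [hφ, hGzero _ h2]
      · simp [hφ, hGzero _ (not_lt.1 h1)]
    have h2 : ∫ z in cyl 1 R 1, f |u z| = ∫ z in cyl 1 R 1, f |u z| * φ z := by
      refine setIntegral_congr_fun (measurableSet_cyl _ _ _) fun z hz => ?_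
      obtain ⟨a, b, c⟩ := mem_cyl_one.1 hz
      simp [hφ, hGone _ a, hGone z.2 (by rwa [abs_of_pos b])]
    rw [h2]
    refine setIntegral_mono_set hfr (Eventually.of_forall fun z =>
      mul_nonneg (hf _ (abs_nonneg _)) (hφ0 z)) (cyl_one_subset_halfSp R).eventuallyLE
  have hD2 : ∫ z in halfSp 1, (cyl 1 r 1 \ cyl 1 R 1).indicator
        (fun z => 2 * C / (r - R) ^ 2 * |u z|) z = 2 * C / (r - R) ^ 2 *
        ((∫ z in cyl 1 r 1, |u z|) - ∫ z in cyl 1 R 1, |u z|) := by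
    rw [setIntegral_indicator hD, inter_eq_self_of_subset_right hDs, integral_const_mul,
      setIntegral_sdiff (measurableSet_cyl _ _ _) hua (cyl_one_mono hr.le)]
  linarith

lemma jensen_cyl {f : ℝ → ℝ} (hf_mono : MonotoneOn f (Ici 0)) (hf_conv : ConvexOn ℝ (Ici 0) f)
    {u : Spc 1 × ℝ → ℝ} {R V : ℝ} (hV : 0 < V)
    (hvol : volume (cyl 1 R 1) = ENNReal.ofReal V) (hu : IntegrableOn u (cyl 1 R 1))
    (hfu : IntegrableOn (fun z => f |u z|) (cyl 1 R 1)) :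
    V * f ((∫ z in cyl 1 R 1, |u z|) / V) ≤ ∫ z in cyl 1 R 1, f |u z| := by
  have h := hf_conv.map_set_average_le (hf_conv.continuousOn_Ici_of_monotoneOn hf_mono)
    isClosed_Ici (μ := volume) (t := cyl 1 R 1) (f := fun z => |u z|)
    (by rw [hvol]; simpa using hV) (by rw [hvol]; simp)
    (Eventually.of_forall fun z => mem_Ici.2 (abs_nonneg _)) hu.abs hfu
  rw [setAverage_eq, setAverage_eq, measureReal_def, hvol, ENNReal.toReal_ofReal hV.le,
    smul_eq_mul, smul_eq_mul, ← div_eq_inv_mul, ← div_eq_inv_mul, le_div_iff₀ hV] at h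
  linarith

lemma exists_cyl_integral_pos {u : Spc 1 × ℝ → ℝ}
    (hu : ∀ r : ℝ, 0 < r → IntegrableOn u (cyl 1 r 1)) (hne : ¬ TrivialSol 1 u) :
    ∃ R : ℝ, 0 < R ∧ 0 < ∫ z in cyl 1 R 1, |u z| := by
  by_contra! hc
  apply hne
  have hU : halfSp 1 ⊆ ⋃ N : ℕ, cyl 1 (N + 1 : ℝ) 1 := by
    intro z hz
    obtain ⟨N, hN⟩ := exists_nat_gt (max |z.1 0| z.2)
    refine mem_iUnion.2 ⟨N, mem_cyl_one.2 ⟨?_, hz, ?_⟩⟩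
    · linarith [le_max_left |z.1 0| z.2]
    · linarith [le_max_right |z.1 0| z.2]
  refine ae_restrict_of_ae_restrict_of_subset hU ?_
  rw [ae_restrict_iUnion_iff]
  intro N
  have hN : (0 : ℝ) < N + 1 := by positivity
  have h0 : ∫ z in cyl 1 (N + 1 : ℝ) 1, |u z| = 0 :=
    le_antisymm (hc _ hN) (integral_nonneg fun z => abs_nonneg _)
  rw [integral_eq_zero_iff_of_nonneg (fun z => abs_nonneg _) (hu _ hN).abs] at h0
  filter_upwards [h0] with z hz
  exact abs_eq_zero.1 hz

/-- **Corollary 2.2.** For `n = 1`, if `∫_1^∞ (f(ζ) ζ)^{-1/2} dζ < ∞`, then any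
global weak solution of the wave problem (WE) is trivial. -/
theorem wave_blowup_dim_one
    (n : ℕ) (hn : n = 1)
    (f : ℝ → ℝ) (hf_mono : MonotoneOn f (Ici 0)) (hf_conv : ConvexOn ℝ (Ici 0) f)
    (hf_pos : ∀ ζ : ℝ, 0 < ζ → 0 < f ζ)
    (u0 u1 : Spc n → ℝ) (hu0 : L1locInit n u0) (hu1 : L1locInit n u1)
    (hu1nn : ∀ᵐ x ∂(volume : Measure (Spc n)), 0 ≤ u1 x)
    (hint : IntegrableOn (fun ζ : ℝ => (f ζ * ζ) ^ (-(1 : ℝ) / 2)) (Ioi 1))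
    (u : Spc n × ℝ → ℝ) (hu : IsGlobalWeakSolWave n f u0 u1 u) :
    TrivialSol n u := by
  subst hn
  have hf0 : ∀ ζ, 0 ≤ ζ → 0 ≤ f ζ := fun ζ => hf_conv.nonneg_of_pos hf_mono hf_pos
  by_contra hne
  obtain ⟨K, hK, hest⟩ := exists_test_estimate
  obtain ⟨ω, hω, hvol⟩ := volume_cyl_one
  obtain ⟨R₁, hR₁, hpos⟩ := exists_cyl_integral_pos hu.1 hne
  replace hest := hest f u0 u1 u hf0 hu1nn hu
  have hui := hu.1
  have hfi := hu.2.1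
  set E : ℝ → ℝ := fun R => ∫ z in cyl 1 R 1, |u z| with hE
  set J : ℝ → ℝ := fun R => ∫ z in cyl 1 R 1, f |u z| with hJ
  have hE0 : ∀ R, 0 ≤ E R := fun R => integral_nonneg fun z => abs_nonneg _
  have hEm : ∀ R r, 0 < R → R ≤ r → E R ≤ E r := fun R r hR hr =>
    setIntegral_mono_set (hui r (hR.trans_le hr)).abs (Eventually.of_forall fun z => abs_nonneg _)
      (cyl_one_mono hr).eventuallyLE
  have hJm : ∀ R r, 0 < R → R ≤ r → J R ≤ J r := fun R r hR hr =>
    setIntegral_mono_set (hfi r (hR.trans_le hr))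
      (Eventually.of_forall fun z => hf0 _ (abs_nonneg _)) (cyl_one_mono hr).eventuallyLE
  have hjen : ∀ R, 0 < R → ω * R ^ 2 * f (E R / (ω * R ^ 2)) ≤ J R := fun R hR =>
    jensen_cyl hf_mono hf_conv (by positivity) (hvol R hR) (hui R hR) (hfi R hR)
  have hgr : ∀ R r, 0 < R → R < r → E R + (r - R) ^ 2 / K * J R ≤ E r := by
    intro R r hR hr
    have h : J R ≤ K / (r - R) ^ 2 * (E r - E R) := hest R r hR hr
    have hd : r - R ≠ 0 := (sub_pos.2 hr).ne'
    have h2 := mul_le_mul_of_nonneg_left h (by positivity : 0 ≤ (r - R) ^ 2 / K)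
    have h3 : (r - R) ^ 2 / K * (K / (r - R) ^ 2 * (E r - E R)) = E r - E R := by
      field_simp
    linarith
  have hJ1 : 0 < J R₁ := by
    refine lt_of_lt_of_le ?_ (hjen R₁ hR₁)
    have := hf_pos (E R₁ / (ω * R₁ ^ 2)) (by positivity)
    positivity
  have hdouble : ∀ R c, 0 < R → c ≤ J R → R ^ 2 / K * c ≤ E (2 * R) := by
    intro R c hR hc
    have h := hgr R (2 * R) hR (by linarith)
    have h2 : R ^ 2 / K * c ≤ R ^ 2 / K * J R := mul_le_mul_of_nonneg_left hc (by positivity)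
    rw [show 2 * R - R = R by ring] at h
    linarith [hE0 R]
  set c₁ : ℝ := J R₁ / (4 * K * ω) with hc₁
  have hc₁0 : 0 < c₁ := by positivity
  have hmean : ∀ R, 2 * R₁ ≤ R → ω * R ^ 2 * f c₁ ≤ J R := by
    intro R hR
    have hR0 : 0 < R := by linarith
    refine le_trans ?_ (hjen R hR0)
    refine mul_le_mul_of_nonneg_left (hf_mono hc₁0.le ?_ ?_) (by positivity)
    · exact div_nonneg (hE0 R) (by positivity)
    · have h := hdouble (R / 2) (J R₁) (by linarith) (hJm _ _ hR₁ (by linarith))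
      rw [show 2 * (R / 2) = R by ring] at h
      rw [le_div_iff₀ (by positivity)]
      refine le_trans (le_of_eq ?_) h
      rw [hc₁]; field_simp; ring
  have hfc := hf_pos c₁ hc₁0
  have hE4 : ∀ R, 2 * R₁ ≤ R → ω * f c₁ / K * R ^ 4 ≤ E (2 * R) := by
    intro R hR
    refine le_trans (le_of_eq ?_) (hdouble R _ (by linarith) (hmean R hR))
    field_simp
  set I : ℝ := ∫ ζ in Ioi (1 : ℝ), (f ζ * ζ) ^ (-(1 : ℝ) / 2) with hI
  set κ : ℝ := 1 / (4 * K) with hκ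
  have hκ0 : 0 < κ := by positivity
  set b : ℝ := max 1 (max (4 * R₁) (max (128 * K / f c₁) (2 / √κ * I))) with hb
  have hb1 : 1 ≤ b := le_max_left _ _
  have hb2 : 4 * R₁ ≤ b := (le_max_left _ _).trans (le_max_right _ _)
  have hb3 : 128 * K / f c₁ ≤ b :=
    (le_max_left _ _).trans ((le_max_right _ _).trans (le_max_right _ _))
  have hb4 : 2 / √κ * I ≤ b :=
    (le_max_right _ _).trans ((le_max_right _ _).trans (le_max_right _ _))
  have hb0 : 0 < b := by linarith
  refine not_growth_of_integrable (h := fun r => E r / (4 * ω * b ^ 2))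
    (B := E (b + b) / (4 * ω * b ^ 2)) (a := b) (L := b) hf_mono hf_pos hint hκ0 ?_ ?_ ?_ hb4
  · have h := hE4 (b / 2) (by linarith)
    rw [show 2 * (b / 2) = b by ring] at h
    rw [le_div_iff₀ (by positivity)]
    refine le_trans ?_ h
    rw [div_le_iff₀ hfc] at hb3
    have h5 : 128 * K ≤ b ^ 2 * f c₁ := by nlinarith
    have h6 : ω * f c₁ / K * (b / 2) ^ 4 = (b ^ 2 * f c₁) * (ω * b ^ 2) / (16 * K) := by
      field_simp; ring
    rw [h6, le_div_iff₀ (by positivity)]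
    nlinarith [mul_le_mul_of_nonneg_right h5 (by positivity : 0 ≤ ω * b ^ 2)]
  · intro r hr hr2
    exact div_le_div_of_nonneg_right (hEm _ _ (by linarith) hr2) (by positivity)
  · intro r s hr hrs hs
    have hr0 : 0 < r := by linarith
    have h1 := hgr r s hr0 hrs
    have h2 : ω * b ^ 2 * f (E r / (4 * ω * b ^ 2)) ≤ J r := by
      refine le_trans ?_ (hjen r hr0)
      have hle : E r / (4 * ω * b ^ 2) ≤ E r / (ω * r ^ 2) := by
        refine div_le_div_of_nonneg_left (hE0 r) (by positivity) ?_
        have : r ^ 2 ≤ (2 * b) ^ 2 := pow_le_pow_left₀ hr0.le (by linarith) 2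
        nlinarith
      have h0 : 0 ≤ E r / (4 * ω * b ^ 2) := div_nonneg (hE0 r) (by positivity)
      refine mul_le_mul ?_ (hf_mono h0 (h0.trans hle) hle) (hf0 _ h0) (by positivity)
      exact mul_le_mul_of_nonneg_left (pow_le_pow_left₀ hb0.le hr 2) hω.le
    have h3 := mul_le_mul_of_nonneg_left h2 (by positivity : 0 ≤ (s - r) ^ 2 / K)
    rw [le_div_iff₀ (by positivity), add_mul, div_mul_cancel₀ _ (by positivity)]
    refine le_trans (le_of_eq ?_) ((add_le_add_right h3 (E r)).trans h1)
    rw [hκ]; field_simp
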